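/- Let m = 2 and n ≥ 1, and let ξ ∈ ℝ^{n×2} be totally irrational with best approximation sequences (X_i), (L_i). If ξ satisfies Property (B) or Property (C), then the uniform exponent satisfies ω̂(ξ) ≤ 2. -/

import Mathlib

open Filter

/-- The sup-norm of the `i`-th integer vector `x i`, viewed in `ℝ^m`. -/
noncomputable def Xval {m : ℕ} (x : ℕ → Fin m → ℤ) (i : ℕ) : ℝ :=
  ‖(fun j => (x i j : ℝ))‖

/-- The sup-norm of the remainder `ξ 𝒙ᵢ − 𝒚ᵢ`. -/
noncomputable def Lval {m n : ℕ} (ξ : Matrix (Fin n) (Fin m) ℝ)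
    (x : ℕ → Fin m → ℤ) (y : ℕ → Fin n → ℤ) (i : ℕ) : ℝ :=
  ‖(ξ.mulVec (fun j => (x i j : ℝ)) - (fun k => (y i k : ℝ)))‖

/-- `ξ` is totally irrational: `‖ξ𝒙 − 𝒚‖ > 0` for every nonzero integer pair `(𝒙,𝒚)`. -/
def TotallyIrrational {m n : ℕ} (ξ : Matrix (Fin n) (Fin m) ℝ) : Prop :=
  ∀ (u : Fin m → ℤ) (v : Fin n → ℤ), (u, v) ≠ 0 →
    0 < ‖(ξ.mulVec (fun j => (u j : ℝ)) - (fun k => (v k : ℝ)))‖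

/-- `(𝒙ᵢ, 𝒚ᵢ)_{i}` is a sequence of best approximation vectors for `ξ`
(with respect to the sup norms). -/
structure IsBestApproxSeq {m n : ℕ} (ξ : Matrix (Fin n) (Fin m) ℝ)
    (x : ℕ → Fin m → ℤ) (y : ℕ → Fin n → ℤ) : Prop where
  nonzero : ∀ i, x i ≠ 0
  first : Xval x 0 = 1
  xStrictMono : StrictMono (Xval x)
  lStrictAnti : StrictAnti (Lval ξ x y)
  best : ∀ (i : ℕ) (u : Fin m → ℤ) (v : Fin n → ℤ), u ≠ 0 →
    ‖(fun j => (u j : ℝ))‖ < Xval x (i + 1) →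
    Lval ξ x y i ≤ ‖(ξ.mulVec (fun j => (u j : ℝ)) - (fun k => (v k : ℝ)))‖

/-- Property (A): `ξ` is badly approximable. -/
def PropA {m n : ℕ} (ξ : Matrix (Fin n) (Fin m) ℝ) : Prop :=
  ∃ c : ℝ, 0 < c ∧ ∀ (u : Fin m → ℤ) (v : Fin n → ℤ), u ≠ 0 →
    c ≤ ‖(fun j => (u j : ℝ))‖ ^ m *
        ‖(ξ.mulVec (fun j => (u j : ℝ)) - (fun k => (v k : ℝ)))‖ ^ n

/-- Property (B): the ratios `X_{i+1}/X_i` are bounded. -/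
def PropB {m : ℕ} (x : ℕ → Fin m → ℤ) : Prop :=
  ∃ M : ℝ, ∀ i : ℕ, Xval x (i + 1) / Xval x i ≤ M

/-- Property (C): the ratios `L_i/L_{i+1}` are bounded. -/
def PropC {m n : ℕ} (ξ : Matrix (Fin n) (Fin m) ℝ)
    (x : ℕ → Fin m → ℤ) (y : ℕ → Fin n → ℤ) : Prop :=
  ∃ M : ℝ, ∀ i : ℕ, Lval ξ x y i / Lval ξ x y (i + 1) ≤ M

/-- The ordinary exponent `ω(ξ) = limsup (−log Lᵢ)/(log Xᵢ)`, as a value in `[0,+∞]`. -/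
noncomputable def ordExp {m n : ℕ} (ξ : Matrix (Fin n) (Fin m) ℝ)
    (x : ℕ → Fin m → ℤ) (y : ℕ → Fin n → ℤ) : EReal :=
  limsup (fun i => ((-Real.log (Lval ξ x y i) / Real.log (Xval x i) : ℝ) : EReal)) atTop

/-- The uniform exponent `ω̂(ξ) = liminf (−log Lᵢ)/(log X_{i+1})`, as a value in `[0,+∞]`. -/
noncomputable def unifExp {m n : ℕ} (ξ : Matrix (Fin n) (Fin m) ℝ)
    (x : ℕ → Fin m → ℤ) (y : ℕ → Fin n → ℤ) : EReal :=
  liminf (fun i => ((-Real.log (Lval ξ x y i) / Real.log (Xval x (i + 1)) : ℝ) : EReal)) atTop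

section Remainder

variable {n : ℕ} (ξ : Matrix (Fin n) (Fin 2) ℝ)

/-- The remainder vector `ξ u - v`. -/
noncomputable def remainder (u : Fin 2 → ℤ) (v : Fin n → ℤ) : Fin n → ℝ :=
  ξ.mulVec (fun j => (u j : ℝ)) - (fun k => (v k : ℝ))

/-- The determinant of two planar integer vectors. -/
def planarDet (a b : Fin 2 → ℤ) : ℤ := a 0 * b 1 - a 1 * b 0

lemma remainder_apply (u : Fin 2 → ℤ) (v : Fin n → ℤ) (k : Fin n) :
    remainder ξ u v k = ξ k 0 * u 0 + ξ k 1 * u 1 - v k := by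
  simp [remainder, Matrix.mulVec, dotProduct, Fin.sum_univ_two]

variable {ξ} {x : ℕ → Fin 2 → ℤ} {y : ℕ → Fin n → ℤ}

lemma abs_remainder_le (i : ℕ) (k : Fin n) : |remainder ξ (x i) (y i) k| ≤ Lval ξ x y i :=
  norm_le_pi_norm (remainder ξ (x i) (y i)) k

lemma abs_le_Xval (i : ℕ) (j : Fin 2) : |(x i j : ℝ)| ≤ Xval x i :=
  norm_le_pi_norm (fun j => (x i j : ℝ)) j

lemma exists_Xval_eq (i : ℕ) : ∃ j, Xval x i = |(x i j : ℝ)| := by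
  obtain ⟨j, -, hj⟩ := Finset.exists_mem_eq_sup' (Finset.univ_nonempty (α := Fin 2))
    (fun j => |(x i j : ℝ)|)
  refine ⟨j, le_antisymm ?_ (abs_le_Xval i j)⟩
  refine (pi_norm_le_iff_of_nonneg (abs_nonneg _)).2 fun l => ?_
  rw [← hj]
  exact Finset.le_sup' (fun j => |(x i j : ℝ)|) (Finset.mem_univ l)

lemma abs_planarDet_le (i l : ℕ) :
    |(planarDet (x i) (x l) : ℝ)| ≤ 2 * (Xval x i * Xval x l) := by
  have key : ∀ j j', |(x i j : ℝ) * x l j'| ≤ Xval x i * Xval x l := fun j j' => by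
    rw [abs_mul]
    exact mul_le_mul (abs_le_Xval i j) (abs_le_Xval l j') (abs_nonneg _) (norm_nonneg _)
  have := abs_sub (x i 0 * x l 1 : ℝ) (x i 1 * x l 0)
  push_cast [planarDet]
  linarith [key 0 1, key 1 0]

namespace IsBestApproxSeq

lemma Lval_pos (hxy : IsBestApproxSeq ξ x y) (i : ℕ) : 0 < Lval ξ x y i :=
  (norm_nonneg _).trans_lt (hxy.lStrictAnti (Nat.lt_succ_self i))

lemma succ_le_Xval (hxy : IsBestApproxSeq ξ x y) (i : ℕ) : (i + 1 : ℝ) ≤ Xval x i := by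
  induction i with
  | zero => simp [hxy.first]
  | succ i ih =>
    have hlt := hxy.xStrictMono (Nat.lt_succ_self i)
    obtain ⟨j, hj⟩ := exists_Xval_eq (x := x) (i + 1)
    have h : ((i + 1 : ℤ) : ℝ) < (|x (i + 1) j| : ℤ) := by
      push_cast
      rw [← hj]
      exact ih.trans_lt hlt
    have h' : ((i + 1 : ℤ) + 1 : ℤ) ≤ |x (i + 1) j| := Int.cast_lt.1 h
    have h'' : (((i + 1 : ℤ) + 1 : ℤ) : ℝ) ≤ (|x (i + 1) j| : ℤ) := Int.cast_le.2 h'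
    push_cast at h'' ⊢
    rwa [hj]

lemma one_le_of_planarDet_eq_zero (hxy : IsBestApproxSeq ξ x y) {i : ℕ}
    (hi : planarDet (x i) (x (i + 1)) = 0) : 1 ≤ 2 * (Xval x (i + 1) * Lval ξ x y i) := by
  have hX := hxy.xStrictMono (Nat.lt_succ_self i)
  have hL := hxy.lStrictAnti (Nat.lt_succ_self i)
  have hLpos := hxy.Lval_pos i
  have hLpos' := hxy.Lval_pos (i + 1)
  obtain ⟨j, hj⟩ := exists_Xval_eq (x := x) (i + 1)
  have hD : (x i 0 : ℝ) * x (i + 1) 1 = x i 1 * x (i + 1) 0 := by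
    exact_mod_cast sub_eq_zero.1 hi
  have hrem : ∀ k, ((x i j * y (i + 1) k - x (i + 1) j * y i k : ℤ) : ℝ) =
      x (i + 1) j * remainder ξ (x i) (y i) k
        - x i j * remainder ξ (x (i + 1)) (y (i + 1)) k := fun k => by
    rw [remainder_apply, remainder_apply]
    push_cast
    fin_cases j
    · simp only [Fin.zero_eta]
      linear_combination ξ k 1 * hD
    · simp only [Fin.mk_one]
      linear_combination -ξ k 0 * hD
  have hbound : ∀ k, |(x i j : ℝ) * remainder ξ (x (i + 1)) (y (i + 1)) k| ≤
      Xval x i * Lval ξ x y (i + 1) := fun k => by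
    rw [abs_mul]
    exact mul_le_mul (abs_le_Xval i j) (abs_remainder_le _ k) (abs_nonneg _) (norm_nonneg _)
  have hX0 : 0 ≤ Xval x i := norm_nonneg _
  by_cases hz : ∀ k, x i j * y (i + 1) k - x (i + 1) j * y i k = 0
  · have hle : Lval ξ x y i ≤ Xval x i * Lval ξ x y (i + 1) / Xval x (i + 1) := by
      refine (pi_norm_le_iff_of_nonneg
        (div_nonneg (mul_nonneg hX0 hLpos'.le) (hX0.trans hX.le))).2 fun k => ?_
      rw [le_div_iff₀ (hX0.trans_lt hX), hj, Real.norm_eq_abs, ← abs_mul]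
      have h := hrem k
      rw [hz k, Int.cast_zero, eq_comm, sub_eq_zero, mul_comm] at h
      exact h ▸ hbound k
    rw [le_div_iff₀ (hX0.trans_lt hX)] at hle
    nlinarith
  · push Not at hz
    obtain ⟨k, hk⟩ := hz
    have h1 : (1 : ℝ) ≤ |((x i j * y (i + 1) k - x (i + 1) j * y i k : ℤ) : ℝ)| := by
      exact_mod_cast Int.one_le_abs hk
    rw [hrem] at h1
    have h2 := h1.trans (abs_sub _ _)
    have h3 : |(x (i + 1) j : ℝ) * remainder ξ (x i) (y i) k| ≤
        Xval x (i + 1) * Lval ξ x y i := by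
      rw [abs_mul]
      exact mul_le_mul (abs_le_Xval _ j) (abs_remainder_le _ k) (abs_nonneg _) (norm_nonneg _)
    nlinarith [hbound k]

/-- The minor of three consecutive best approximations on both `x`-rows and the `k`-th `y`-row. -/
def tripleMinor (x : ℕ → Fin 2 → ℤ) (y : ℕ → Fin n → ℤ) (i : ℕ) (k : Fin n) : ℤ :=
  planarDet (x (i + 1)) (x (i + 2)) * y i k - planarDet (x i) (x (i + 2)) * y (i + 1) k
    + planarDet (x i) (x (i + 1)) * y (i + 2) k

lemma tripleMinor_eq (ξ : Matrix (Fin n) (Fin 2) ℝ) (x : ℕ → Fin 2 → ℤ) (y : ℕ → Fin n → ℤ)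
    (i : ℕ) (k : Fin n) : (tripleMinor x y i k : ℝ) =
      -(planarDet (x (i + 1)) (x (i + 2)) * remainder ξ (x i) (y i) k
        - planarDet (x i) (x (i + 2)) * remainder ξ (x (i + 1)) (y (i + 1)) k
        + planarDet (x i) (x (i + 1)) * remainder ξ (x (i + 2)) (y (i + 2)) k) := by
  simp only [tripleMinor, remainder_apply, planarDet]
  push_cast
  ring

lemma one_le_of_tripleMinor_ne_zero (hxy : IsBestApproxSeq ξ x y) {i : ℕ} {k : Fin n}
    (hk : tripleMinor x y i k ≠ 0) :
    1 ≤ 6 * (Xval x (i + 1) * Xval x (i + 2) * Lval ξ x y i) := by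
  have hX := (hxy.xStrictMono (Nat.lt_succ_self i)).le
  have hX' := (hxy.xStrictMono (Nat.lt_succ_self (i + 1))).le
  have hL := (hxy.lStrictAnti (Nat.lt_succ_self i)).le
  have hL' := (hxy.lStrictAnti (Nat.lt_succ_self (i + 1))).le
  simp only [Nat.succ_eq_add_one, add_assoc, Nat.reduceAdd] at hX hX' hL hL'
  have h0 : ∀ l, 0 ≤ Xval x l := fun _ => norm_nonneg _
  have hL0 := fun l => (hxy.Lval_pos l).le
  have h1 : (1 : ℝ) ≤ |(tripleMinor x y i k : ℝ)| := by exact_mod_cast Int.one_le_abs hk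
  rw [tripleMinor_eq ξ, abs_neg] at h1
  have hterm : ∀ a b c, Xval x a * Xval x b ≤ Xval x (i + 1) * Xval x (i + 2) →
      Lval ξ x y c ≤ Lval ξ x y i →
      |(planarDet (x a) (x b) : ℝ) * remainder ξ (x c) (y c) k| ≤
        2 * (Xval x (i + 1) * Xval x (i + 2) * Lval ξ x y i) := fun a b c hab hc => by
    rw [abs_mul, ← mul_assoc]
    exact mul_le_mul ((abs_planarDet_le a b).trans (by linarith))
      ((abs_remainder_le c k).trans hc) (abs_nonneg _)
      (mul_nonneg zero_le_two (mul_nonneg (h0 _) (h0 _)))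
  have t1 := hterm (i + 1) (i + 2) i le_rfl le_rfl
  have t2 := hterm i (i + 2) (i + 1) (mul_le_mul_of_nonneg_right hX (h0 _)) hL
  have t3 := hterm i (i + 1) (i + 2)
    (mul_le_mul hX hX' (h0 _) (h0 _)) (hL'.trans hL)
  have a1 := abs_add_le
    ((planarDet (x (i + 1)) (x (i + 2)) : ℝ) * remainder ξ (x i) (y i) k
      - planarDet (x i) (x (i + 2)) * remainder ξ (x (i + 1)) (y (i + 1)) k)
    (planarDet (x i) (x (i + 1)) * remainder ξ (x (i + 2)) (y (i + 2)) k)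
  have a2 := abs_sub
    ((planarDet (x (i + 1)) (x (i + 2)) : ℝ) * remainder ξ (x i) (y i) k)
    (planarDet (x i) (x (i + 2)) * remainder ξ (x (i + 1)) (y (i + 1)) k)
  linarith

/-- A mixed `2 × 2` minor of two consecutive pairs `(𝒙ᵢ, ξ𝒙ᵢ - 𝒚ᵢ)`. -/
noncomputable def mixedMinor (ξ : Matrix (Fin n) (Fin 2) ℝ) (x : ℕ → Fin 2 → ℤ)
    (y : ℕ → Fin n → ℤ) (j : Fin 2) (k : Fin n) (i : ℕ) : ℝ :=
  x i j * remainder ξ (x (i + 1)) (y (i + 1)) k - x (i + 1) j * remainder ξ (x i) (y i) k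

lemma abs_mixedMinor_le (hxy : IsBestApproxSeq ξ x y) (j : Fin 2) (k : Fin n) (i : ℕ) :
    |mixedMinor ξ x y j k i| ≤ 2 * (Xval x (i + 1) * Lval ξ x y i) := by
  have hX := (hxy.xStrictMono (Nat.lt_succ_self i)).le
  have hL := (hxy.lStrictAnti (Nat.lt_succ_self i)).le
  have h0 : ∀ l, 0 ≤ Xval x l := fun _ => norm_nonneg _
  have hterm : ∀ a b, Xval x a ≤ Xval x (i + 1) → Lval ξ x y b ≤ Lval ξ x y i →
      |(x a j : ℝ) * remainder ξ (x b) (y b) k| ≤ Xval x (i + 1) * Lval ξ x y i :=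
    fun a b ha hb => by
      rw [abs_mul]
      exact mul_le_mul ((abs_le_Xval a j).trans ha) ((abs_remainder_le b k).trans hb)
        (abs_nonneg _) (h0 _)
  have h := abs_sub ((x i j : ℝ) * remainder ξ (x (i + 1)) (y (i + 1)) k)
    (x (i + 1) j * remainder ξ (x i) (y i) k)
  unfold mixedMinor
  linarith [hterm i (i + 1) hX hL, hterm (i + 1) i le_rfl le_rfl]

lemma mixedMinor_succ_mul (j : Fin 2) (k : Fin n) (i : ℕ) (hk : tripleMinor x y i k = 0) :
    mixedMinor ξ x y j k (i + 1) * planarDet (x i) (x (i + 1)) =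
      mixedMinor ξ x y j k i * planarDet (x (i + 1)) (x (i + 2)) := by
  have h := tripleMinor_eq ξ x y i k
  rw [hk, Int.cast_zero] at h
  have hx : (planarDet (x (i + 1)) (x (i + 2)) : ℝ) * x i j
      - planarDet (x i) (x (i + 2)) * x (i + 1) j
      + planarDet (x i) (x (i + 1)) * x (i + 2) j = 0 := by
    simp only [planarDet]
    push_cast
    fin_cases j
    · simp only [Fin.zero_eta]
      ring
    · simp only [Fin.mk_one]
      ring
  simp only [mixedMinor, add_assoc, Nat.reduceAdd]
  linear_combination (x (i + 1) j : ℝ) * h - remainder ξ (x (i + 1)) (y (i + 1)) k * hx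

lemma exists_mixedMinor_ne_zero (hxy : IsBestApproxSeq ξ x y) {i : ℕ}
    (hi : planarDet (x i) (x (i + 1)) ≠ 0) : ∃ j k, mixedMinor ξ x y j k i ≠ 0 := by
  by_contra! hc
  refine (hxy.Lval_pos i).ne' (norm_eq_zero.2 (funext fun k => ?_))
  have h0 := hc 0 k
  have h1 := hc 1 k
  have hD : (planarDet (x i) (x (i + 1)) : ℝ) ≠ 0 := Int.cast_ne_zero.2 hi
  refine (mul_eq_zero.1 (?_ : (planarDet (x i) (x (i + 1)) : ℝ) *
    remainder ξ (x i) (y i) k = 0)).resolve_left hD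
  simp only [mixedMinor] at h0 h1
  simp only [planarDet]
  push_cast
  linear_combination (x i 1 : ℝ) * h0 - (x i 0 : ℝ) * h1

/-- If eventually all `2 × 2` determinants are nonzero and all triple minors vanish, then
`X_{i+1} L_i` is bounded below. -/
lemma exists_pos_le_of_tripleMinor_eq_zero (hxy : IsBestApproxSeq ξ x y) {N : ℕ}
    (hD : ∀ i ≥ N, planarDet (x i) (x (i + 1)) ≠ 0)
    (hT : ∀ i ≥ N, ∀ k, tripleMinor x y i k = 0) :
    ∃ c > 0, ∀ i ≥ N, c ≤ Xval x (i + 1) * Lval ξ x y i := by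
  obtain ⟨j, k, hjk⟩ := hxy.exists_mixedMinor_ne_zero (hD N le_rfl)
  have hDN : (planarDet (x N) (x (N + 1)) : ℝ) ≠ 0 := Int.cast_ne_zero.2 (hD N le_rfl)
  set κ := mixedMinor ξ x y j k N / planarDet (x N) (x (N + 1)) with hκ
  have hκ0 : 0 < |κ| := abs_pos.2 (div_ne_zero hjk hDN)
  have hW : ∀ i ≥ N, mixedMinor ξ x y j k i = κ * planarDet (x i) (x (i + 1)) := by
    intro i hi
    induction i, hi using Nat.le_induction with
    | base => rw [hκ, div_mul_cancel₀ _ hDN]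
    | succ i hi ih =>
      have hDi : (planarDet (x i) (x (i + 1)) : ℝ) ≠ 0 := Int.cast_ne_zero.2 (hD i hi)
      refine mul_right_cancel₀ hDi ?_
      rw [mixedMinor_succ_mul j k i (hT i hi k), ih]
      ring
  refine ⟨|κ| / 2, half_pos hκ0, fun i hi => ?_⟩
  have h1 : (1 : ℝ) ≤ |(planarDet (x i) (x (i + 1)) : ℝ)| := by
    exact_mod_cast Int.one_le_abs (hD i hi)
  have h2 := hxy.abs_mixedMinor_le j k i
  rw [hW i hi, abs_mul] at h2
  nlinarith

lemma exists_frequently_le_sq_mul (hxy : IsBestApproxSeq ξ x y) (h : PropB x ∨ PropC ξ x y) :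
    ∃ c > 0, ∃ᶠ i in atTop, c ≤ Xval x (i + 1) ^ 2 * Lval ξ x y i := by
  have hX1 : ∀ i, 1 ≤ Xval x i := fun i =>
    le_trans (by linarith [i.cast_nonneg (α := ℝ)]) (hxy.succ_le_Xval i)
  have hsq : ∀ i, Xval x (i + 1) * Lval ξ x y i ≤ Xval x (i + 1) ^ 2 * Lval ξ x y i := fun i =>
    mul_le_mul_of_nonneg_right (le_self_pow₀ (hX1 _) two_ne_zero) (hxy.Lval_pos i).le
  by_cases hD : ∃ᶠ i in atTop, planarDet (x i) (x (i + 1)) = 0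
  · refine ⟨1 / 2, by norm_num, hD.mono fun i hi => ?_⟩
    linarith [hxy.one_le_of_planarDet_eq_zero hi, hsq i]
  by_cases hT : ∃ᶠ i in atTop, ∃ k, tripleMinor x y i k ≠ 0
  · rcases h with ⟨M, hM⟩ | ⟨M, hM⟩
    · have hMpos : 0 < M := lt_of_lt_of_le
        (div_pos (zero_lt_one.trans_le (hX1 1)) (zero_lt_one.trans_le (hX1 0))) (hM 0)
      refine ⟨1 / (6 * M), by positivity, hT.mono fun i ⟨k, hk⟩ => ?_⟩
      have h1 := hxy.one_le_of_tripleMinor_ne_zero hk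
      have h2 : Xval x (i + 2) ≤ M * Xval x (i + 1) :=
        (div_le_iff₀ (zero_lt_one.trans_le (hX1 _))).1 (hM (i + 1))
      have h3 := mul_le_mul_of_nonneg_left h2
        (mul_nonneg (zero_le_one.trans (hX1 (i + 1))) (hxy.Lval_pos i).le)
      rw [div_le_iff₀ (by positivity)]
      linarith
    · have hMpos : 0 < M := lt_of_lt_of_le (div_pos (hxy.Lval_pos 0) (hxy.Lval_pos 1)) (hM 0)
      refine ⟨1 / (6 * M), by positivity, (tendsto_add_atTop_nat 1).frequently
        (hT.mono fun i ⟨k, hk⟩ => ?_)⟩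
      have h1 := hxy.one_le_of_tripleMinor_ne_zero hk
      have h2 : Lval ξ x y i ≤ M * Lval ξ x y (i + 1) :=
        (div_le_iff₀ (hxy.Lval_pos _)).1 (hM i)
      have h3 : Xval x (i + 1) * Xval x (i + 2) * Lval ξ x y i ≤
          Xval x (i + 2) * Xval x (i + 2) * (M * Lval ξ x y (i + 1)) := by
        have := zero_le_one.trans (hX1 (i + 2))
        exact mul_le_mul (mul_le_mul_of_nonneg_right
          (hxy.xStrictMono (Nat.lt_succ_self (i + 1))).le this) h2 (hxy.Lval_pos i).le
          (mul_nonneg this this)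
      rw [div_le_iff₀ (by positivity)]
      simp only [add_assoc, Nat.reduceAdd]
      linarith
  · rw [not_frequently] at hD hT
    obtain ⟨N, hN⟩ := eventually_atTop.1 (hD.and hT)
    obtain ⟨c, hc, hle⟩ := hxy.exists_pos_le_of_tripleMinor_eq_zero
      (fun i hi => (hN i hi).1) (fun i hi k => not_not.1 fun hk => (hN i hi).2 ⟨k, hk⟩)
    exact ⟨c, hc, ((eventually_ge_atTop N).mono fun i hi => (hle i hi).trans (hsq i)).frequently⟩

lemma unifExp_le_two_of_frequently (hxy : IsBestApproxSeq ξ x y) {c : ℝ} (hc : 0 < c)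
    (hf : ∃ᶠ i in atTop, c ≤ Xval x (i + 1) ^ 2 * Lval ξ x y i) :
    unifExp ξ x y ≤ (2 : EReal) := by
  refine EReal.le_of_forall_lt_iff_le.1 fun z hz => ?_
  have hz2 : (2 : ℝ) < z := EReal.coe_lt_coe_iff.1 hz
  have hXtop : Tendsto (fun i => Real.log (Xval x (i + 1))) atTop atTop :=
    Real.tendsto_log_atTop.comp ((tendsto_atTop_mono hxy.succ_le_Xval
      (tendsto_natCast_atTop_atTop.atTop_add tendsto_const_nhds)).comp (tendsto_add_atTop_nat 1))
  refine liminf_le_of_frequently_le' ((hf.and_eventually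
    ((hXtop.eventually_gt_atTop 0).and
      (hXtop.eventually_ge_atTop (-Real.log c / (z - 2))))).mono ?_)
  rintro i ⟨hi, hpos, hlarge⟩
  have hX : 0 < Xval x (i + 1) :=
    lt_of_lt_of_le (by positivity) (hxy.succ_le_Xval (i + 1))
  have hlog := Real.log_le_log hc hi
  rw [Real.log_mul (by positivity) (hxy.Lval_pos i).ne', Real.log_pow] at hlog
  rw [div_le_iff₀ (sub_pos.2 hz2)] at hlarge
  refine EReal.coe_le_coe_iff.2 ((div_le_iff₀ hpos).2 ?_)
  push_cast at hlog
  linarith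

end IsBestApproxSeq

end Remainder

/-- For `m = 2, n ≥ 1`: property (B) or (C) implies `ω̂(ξ) ≤ 2`. -/
theorem stmt_17 (n : ℕ) (hn : 1 ≤ n)
    (ξ : Matrix (Fin n) (Fin 2) ℝ) (hirr : TotallyIrrational ξ)
    (x : ℕ → Fin 2 → ℤ) (y : ℕ → Fin n → ℤ) (hxy : IsBestApproxSeq ξ x y)
    (h : PropB x ∨ PropC ξ x y) :
    unifExp ξ x y ≤ (2 : EReal) := by
  obtain ⟨c, hc, hf⟩ := hxy.exists_frequently_le_sq_mul h
  exact hxy.unifExp_le_two_of_frequently hc hf
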